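/- Decomposition of the Lagrangian relaxation into single-target subproblems: let 0 < β < 1, let N be a positive natural number, for each n ∈ Fin N let S_n be a type (state space of target n), let A be a nonempty finite type (actions), let φ_n : S_n → A → S_n be deterministic transition maps, and let c_n : S_n → A → ℝ be per-stage cost functions satisfying 0 ≤ c_n(s,a) ≤ C for some constant C. Given initial states s_{n,0}, for a joint action sequence α : ℕ → (Fin N → A) define the trajectories by s_{n,t+1} = φ_n(s_{n,t}, α_t(n)). Then the infimum over all joint action sequences α of the total discounted cost ∑'_{t} β^t ∑_{n} c_n(s_{n,t}, α_t(n)) equals the sum over n of the infima of the single-target discounted costs: inf_α ∑'_t β^t ∑_n c_n(s_{n,t}, α_t(n)) = ∑_n inf_{a : ℕ → A} ∑'_t β^t c_n(s_{n,t}(a), a_t), where s_{n,t}(a) is the trajectory of target n driven by the individual action sequence a. Consequently, the optimal value of the joint Lagrangian problem equals the sum of the optimal values of the N independent single-target subproblems (minus the constant Kλ/(1−β) when the constant −λK per stage is included). -/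

import Mathlib

/-- The trajectory of a deterministic controlled system: `traj φ s0 acts t` is
the state at time `t` when starting at `s0` and applying actions `acts`. -/
def traj {S A : Type*} (φ : S → A → S) (s0 : S) (acts : ℕ → A) : ℕ → S
  | 0 => s0
  | t + 1 => φ (traj φ s0 acts t) (acts t)

/-- The infimum of a separable sum over independently chosen sequences is the sum of the infima. -/
theorem ciInf_sum_swap {ι T A : Type*} [Fintype ι] [Nonempty A]
    (F : ι → (T → A) → ℝ) (hF : ∀ i, BddBelow (Set.range (F i))) :
    (⨅ α : T → ι → A, ∑ i, F i (fun t => α t i)) = ∑ i, ⨅ a : T → A, F i a := by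
  have hle : ∀ α : T → ι → A, ∑ i, ⨅ a, F i a ≤ ∑ i, F i (fun t => α t i) := fun α =>
    Finset.sum_le_sum fun i _ => ciInf_le (hF i) _
  refine le_antisymm (le_of_forall_pos_le_add fun ε hε => ?_) (le_ciInf hle)
  have hδ : 0 < ε / (Fintype.card ι + 1) := by positivity
  choose a ha using fun i => exists_lt_of_ciInf_lt (lt_add_of_pos_right (⨅ a, F i a) hδ)
  calc (⨅ α : T → ι → A, ∑ i, F i (fun t => α t i))
      ≤ ∑ i, F i (a i) :=
        ciInf_le ⟨_, Set.forall_mem_range.2 hle⟩ (fun t i => a i t)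
    _ ≤ ∑ i, ((⨅ a, F i a) + ε / (Fintype.card ι + 1)) :=
        Finset.sum_le_sum fun i _ => (ha i).le
    _ = (∑ i, ⨅ a, F i a) + Fintype.card ι * (ε / (Fintype.card ι + 1)) := by
        simp [Finset.sum_add_distrib]
    _ ≤ (∑ i, ⨅ a, F i a) + ε := by
        gcongr
        rw [← mul_div_assoc, div_le_iff₀ (by positivity)]
        nlinarith

/-- Decomposition of the Lagrangian relaxation into single-target subproblems:
for uncoupled targets with deterministic dynamics and bounded nonnegative
per-stage costs, the optimal joint discounted cost equals the sum of the
optimal single-target discounted costs. -/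
theorem lagrangian_decomposition
    (β : ℝ) (hβ0 : 0 < β) (hβ1 : β < 1)
    (N : ℕ) (hN : 0 < N)
    (S : Fin N → Type*) (A : Type*) [Nonempty A] [Fintype A]
    (φ : ∀ n : Fin N, S n → A → S n)
    (c : ∀ n : Fin N, S n → A → ℝ)
    (C : ℝ)
    (hc0 : ∀ (n : Fin N) (s : S n) (a : A), 0 ≤ c n s a)
    (hcC : ∀ (n : Fin N) (s : S n) (a : A), c n s a ≤ C)
    (s0 : ∀ n : Fin N, S n) :
    (⨅ α : ℕ → Fin N → A,
        ∑' t : ℕ, β ^ t * ∑ n : Fin N,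
          c n (traj (φ n) (s0 n) (fun u => α u n) t) (α t n))
      = ∑ n : Fin N,
          ⨅ a : ℕ → A, ∑' t : ℕ, β ^ t * c n (traj (φ n) (s0 n) a t) (a t) := by
  have hsum : ∀ (n : Fin N) (a : ℕ → A),
      Summable fun t => β ^ t * c n (traj (φ n) (s0 n) a t) (a t) := fun n a =>
    Summable.of_nonneg_of_le (fun t => mul_nonneg (pow_nonneg hβ0.le t) (hc0 n _ _))
      (fun t => mul_le_mul_of_nonneg_left (hcC n _ _) (pow_nonneg hβ0.le t))
      ((summable_geometric_of_lt_one hβ0.le hβ1).mul_right C)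
  rw [← ciInf_sum_swap (fun n (a : ℕ → A) =>
    ∑' t : ℕ, β ^ t * c n (traj (φ n) (s0 n) a t) (a t))]
  · refine iInf_congr fun α => ?_
    simp only [Finset.mul_sum]
    exact Summable.tsum_finsetSum fun n _ => hsum n fun u => α u n
  · exact fun n => ⟨0, Set.forall_mem_range.2 fun a =>
      tsum_nonneg fun t => mul_nonneg (pow_nonneg hβ0.le t) (hc0 n _ _)⟩
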